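/- arXiv:math/0306248 — 2 statements merged into one kernel-verified Lean document; each statement's English description precedes it below -/
import Mathlib

section
/- Let q be an irreducible transition matrix on S with stationary distribution μ, and let C be a nonempty proper subset of S. For s ∈ C define ν_C(s) = (Σ_{t∉C} μ_t q(s|t)) / (Σ_{t∉C} μ_t q(C|t)), where q(C|t) = Σ_{u∈C} q(u|t) (the denominator is positive by irreducibility). Then Σ_{s∈C} ν_C(s)·E_{s,q}[T_{C̄}] = μ_C / (Σ_{s∈C} μ_s q(C̄|s)); that is, the average length of a visit to C equals the stationary mass of C divided by the stationary flow out of C. -/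
open Finset

namespace PerturbedMC

variable {S : Type*} [Fintype S] [DecidableEq S]

/-- `q` is a (row-stochastic) transition matrix on `S`: `q s t` is the probability of moving
from `s` to `t`. -/
def IsTransition (q : Matrix S S ℝ) : Prop :=
  (∀ s t, 0 ≤ q s t) ∧ ∀ s, ∑ t, q s t = 1

/-- `q` is irreducible. -/
def IsIrreducible (q : Matrix S S ℝ) : Prop :=
  ∀ s t, ∃ n : ℕ, 1 ≤ n ∧ 0 < (q ^ n) s t

/-- `μ` is a stationary distribution of `q`. -/
def IsStationary (q : Matrix S S ℝ) (μ : S → ℝ) : Prop :=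
  (∀ s, 0 ≤ μ s) ∧ (∑ s, μ s = 1) ∧ ∀ t, ∑ s, μ s * q s t = μ t

/-- The combinatorial constant `L = ∑_{n=1}^{|S|-1} C(|S|,n) · n^{|S|}`. -/
def Lconst (S : Type*) [Fintype S] : ℕ :=
  ∑ n ∈ Finset.Ico 1 (Fintype.card S), (Fintype.card S).choose n * n ^ Fintype.card S

/-- `ζ_q`: the minimal stationary outflow over nonempty proper subsets of `S`. -/
noncomputable def zeta (q : Matrix S S ℝ) (μ : S → ℝ) : ℝ :=
  sInf {x : ℝ | ∃ C : Finset S, C.Nonempty ∧ C ≠ Finset.univ ∧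
    x = ∑ s ∈ C, μ s * ∑ t ∈ Cᶜ, q s t}

/-- `ζ_q^1`: the minimal stationary outflow over nonempty proper subsets of `S₁`. -/
noncomputable def zeta1 (q : Matrix S S ℝ) (μ : S → ℝ) (S1 : Finset S) : ℝ :=
  sInf {x : ℝ | ∃ C : Finset S, C.Nonempty ∧ C ⊂ S1 ∧
    x = ∑ s ∈ C, μ s * ∑ t ∈ Cᶜ, q s t}

/-- `q̂` is `(ε,β)`-close to `q`, relative to the threshold `z` (`z = ζ_q` or `z = ζ_q^1`):
`|q̂(t|s) − q(t|s)| ≤ β·q(t|s)` whenever `μ_s q(t|s) ≥ ε·z` or `μ_s q̂(t|s) ≥ ε·z`. -/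
def IsClose (q qh : Matrix S S ℝ) (μ : S → ℝ) (z ε β : ℝ) : Prop :=
  ∀ s t, (ε * z ≤ μ s * q s t ∨ ε * z ≤ μ s * qh s t) → |qh s t - q s t| ≤ β * q s t

/-- The substochastic `C × C` restriction `q_C` of `q`. -/
def subMat (q : Matrix S S ℝ) (C : Finset S) : Matrix S S ℝ :=
  fun u v => if u ∈ C ∧ v ∈ C then q u v else 0

/-- The exit distribution `Q_{s,q}(t|C) = Σ_{n≥0} Σ_{u∈C} (q_C^n)(u|s)·q(t|u)`. -/
noncomputable def exitProb (q : Matrix S S ℝ) (C : Finset S) (s t : S) : ℝ :=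
  ∑' n : ℕ, ∑ u ∈ C, ((subMat q C ^ n : Matrix S S ℝ) s u) * q u t

/-- The expected exit time `E_{s,q}[T_{C̄}] = Σ_{n≥0} Σ_{u∈C} (q_C^n)(u|s) ∈ [0,∞]`. -/
noncomputable def expExit (q : Matrix S S ℝ) (C : Finset S) (s : S) : ENNReal :=
  ∑' n : ℕ, ENNReal.ofReal (∑ u ∈ C, (subMat q C ^ n : Matrix S S ℝ) s u)

/-- `g` has a cycle within `C`. -/
def HasCycle (C : Finset S) (g : S → S) : Prop :=
  ∃ (k : ℕ) (f : ℕ → S), 0 < k ∧ f k = f 0 ∧ (∀ i < k, f i ∈ C) ∧ ∀ i < k, g (f i) = f (i + 1)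

/-- `g` is a `C`-graph (the values of `g` outside `C` are irrelevant). -/
def IsCGraph (C : Finset S) (g : S → S) : Prop := ¬ HasCycle C g

/-- `s` leads to `t` along `g`: `t` is the first state outside `C` on the `g`-orbit of `s`. -/
def LeadsTo (C : Finset S) (g : S → S) (s t : S) : Prop :=
  ∃ n : ℕ, g^[n] s = t ∧ t ∉ C ∧ ∀ m < n, g^[m] s ∈ C

/-- The weight `p(g) = Π_{s∈C} q(g(s)|s)` of a `C`-graph under `q`. -/
def wt (q : Matrix S S ℝ) (C : Finset S) (g : S → S) : ℝ := ∏ s ∈ C, q s (g s)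

/-- `G(C)`: the canonical representatives of `C`-graphs, namely the maps `S → S` that are
`C`-graphs and are the identity outside `C`. -/
noncomputable def Gset (C : Finset S) : Finset (S → S) :=
  @Finset.filter _ (fun g => IsCGraph C g ∧ ∀ s ∉ C, g s = s) (Classical.decPred _) Finset.univ

/-- `G_{s,t}(C)`: the `C`-graphs along which `s` leads to `t`. -/
noncomputable def GsetLead (C : Finset S) (s t : S) : Finset (S → S) :=
  @Finset.filter _ (fun g => LeadsTo C g s t) (Classical.decPred _) (Gset C)

/-- `g` is an `η`-maximal `C`-graph under `q`: `p(g) ≥ η · max_{g' ∈ G(C)} p(g')`. -/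
def IsMaximal (q : Matrix S S ℝ) (C : Finset S) (η : ℝ) (g : S → S) : Prop :=
  IsCGraph C g ∧ ∀ g', IsCGraph C g' → η * wt q C g' ≤ wt q C g

/-- `H = G^β(C) ∪ Ĝ^β(C)` as a finset of canonical representatives. -/
noncomputable def Hset (q qh : Matrix S S ℝ) (C : Finset S) (β : ℝ) : Finset (S → S) :=
  @Finset.filter _ (fun g => IsMaximal q C β g ∨ IsMaximal qh C β g)
    (Classical.decPred _) (Gset C)

/-- The mixing hypothesis with parameter `a` on `S₁`: for all `s,t ∈ S₁`, the probability
that the chain started at `s`, from its first step onward, reaches `t` before reaching any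
state of `S \ S₁`, is at least `a`. -/
def Mixing (q : Matrix S S ℝ) (S1 : Finset S) (a : ℝ) : Prop :=
  ∀ s ∈ S1, ∀ t ∈ S1,
    a ≤ q s t + ∑ u ∈ S1.erase t, q s u * exitProb q (S1.erase t) u t

/-- `R` is a recurrent class for `q`. -/
def IsRecClass (q : Matrix S S ℝ) (R : Finset S) : Prop :=
  (∀ s ∈ R, ∑ t ∈ Rᶜ, q s t = 0) ∧
    ∀ s ∈ R, ∀ t ∈ R, ∃ n : ℕ, 1 ≤ n ∧ 0 < (q ^ n) s t

open Matrix Filter Topology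

/-- A nonnegative row vector that vanishes somewhere and is dominated by its image under an
irreducible transition matrix is zero. -/
lemma IsIrreducible.eq_zero_of_le_vecMul {q : Matrix S S ℝ} (hqirr : IsIrreducible q)
    (hq : IsTransition q) {w : S → ℝ} (hw0 : ∀ s, 0 ≤ w s) (hw : ∀ s, w s ≤ (w ᵥ* q) s)
    {t : S} (ht : w t = 0) : w = 0 := by
  have hsum : ∑ s, w s = ∑ s, (w ᵥ* q) s := by
    simp only [vecMul, dotProduct]
    rw [Finset.sum_comm]
    simp only [← Finset.mul_sum, hq.2, mul_one]
  have hinv : w ᵥ* q = w := by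
    funext s
    exact (((Finset.sum_eq_sum_iff_of_le fun s _ => hw s).1 hsum) s (Finset.mem_univ s)).symm
  have hpow : ∀ n : ℕ, w ᵥ* q ^ n = w := by
    intro n
    induction n with
    | zero => simp
    | succ n ih => rw [pow_succ, ← vecMul_vecMul, ih, hinv]
  have hpow0 : ∀ (n : ℕ) (s t : S), 0 ≤ (q ^ n) s t := by
    intro n
    induction n with
    | zero => intro s t; rw [pow_zero, one_apply]; split_ifs <;> norm_num
    | succ n ih =>
      intro s t
      rw [pow_succ, mul_apply]
      exact Finset.sum_nonneg fun u _ => mul_nonneg (ih s u) (hq.1 u t)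
  funext s
  obtain ⟨n, -, hn⟩ := hqirr s t
  have hzero : ∑ u, w u * (q ^ n) u t = 0 := (congrFun (hpow n) t).trans ht
  have := (Finset.sum_eq_zero_iff_of_nonneg fun u _ => mul_nonneg (hw0 u) (hpow0 n u t)).1 hzero s
    (Finset.mem_univ s)
  exact (mul_eq_zero.1 this).resolve_right hn.ne'

lemma subMat_nonneg {q : Matrix S S ℝ} (hq : IsTransition q) (C : Finset S) (s t : S) :
    0 ≤ subMat q C s t := by
  unfold subMat
  split_ifs
  exacts [hq.1 s t, le_rfl]

lemma subMat_le {q : Matrix S S ℝ} (hq : IsTransition q) (C : Finset S) (s t : S) :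
    subMat q C s t ≤ q s t := by
  unfold subMat
  split_ifs
  exacts [le_rfl, hq.1 s t]

lemma subMat_pow_nonneg {q : Matrix S S ℝ} (hq : IsTransition q) (C : Finset S) (n : ℕ)
    (s t : S) : 0 ≤ (subMat q C ^ n) s t := by
  induction n generalizing s t with
  | zero => rw [pow_zero, one_apply]; split_ifs <;> norm_num
  | succ n ih =>
    rw [pow_succ, mul_apply]
    exact Finset.sum_nonneg fun u _ => mul_nonneg (ih s u) (subMat_nonneg hq C u t)

/-- The mass remaining in a proper subset `C` tends to zero when it starts from a nonnegative
vector on `C` that is superinvariant for `q_C`. -/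
lemma tendsto_vecMul_subMat_pow {q : Matrix S S ℝ} (hq : IsTransition q)
    (hqirr : IsIrreducible q) {C : Finset S} (hC : C ≠ Finset.univ) {v : S → ℝ}
    (hv0 : ∀ s, 0 ≤ v s) (hvC : ∀ s ∉ C, v s = 0) (hv : ∀ s, (v ᵥ* subMat q C) s ≤ v s) (s : S) :
    Tendsto (fun n : ℕ => (v ᵥ* subMat q C ^ n) s) atTop (𝓝 0) := by
  have hnonneg : ∀ (n : ℕ) (s : S), 0 ≤ (v ᵥ* subMat q C ^ n) s := fun n s =>
    Finset.sum_nonneg fun u _ => mul_nonneg (hv0 u) (subMat_pow_nonneg hq C n u s)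
  have hanti : ∀ s, Antitone fun n : ℕ => (v ᵥ* subMat q C ^ n) s := by
    intro s
    refine antitone_nat_of_succ_le fun n => ?_
    rw [pow_succ', ← vecMul_vecMul]
    exact Finset.sum_le_sum fun u _ =>
      mul_le_mul_of_nonneg_right (hv u) (subMat_pow_nonneg hq C n u s)
  have hlim : ∀ s, ∃ l, Tendsto (fun n : ℕ => (v ᵥ* subMat q C ^ n) s) atTop (𝓝 l) := fun s =>
    ⟨_, tendsto_atTop_ciInf (hanti s) ⟨0, by rintro _ ⟨n, rfl⟩; exact hnonneg n s⟩⟩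
  choose w hw using hlim
  have hw0 : ∀ s, 0 ≤ w s := fun s => ge_of_tendsto' (hw s) fun n => hnonneg n s
  have hwP : ∀ s, (w ᵥ* subMat q C) s = w s := by
    intro s
    refine tendsto_nhds_unique ?_ ((tendsto_add_atTop_iff_nat 1).2 (hw s))
    simp only [pow_succ, ← vecMul_vecMul]
    exact tendsto_finsetSum _ fun u _ => (hw u).mul_const _
  obtain ⟨t, ht⟩ : ∃ t, t ∉ C := by
    by_contra! h
    exact hC (Finset.eq_univ_iff_forall.2 h)
  have hwt : w t = 0 :=
    le_antisymm ((hanti t).le_of_tendsto (hw t) 0 |>.trans (by simp [hvC t ht])) (hw0 t)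
  have hw_zero : w = 0 := hqirr.eq_zero_of_le_vecMul hq hw0 (fun s => (hwP s).symm.le.trans
    (Finset.sum_le_sum fun u _ => mul_le_mul_of_nonneg_left (subMat_le hq C u s) (hw0 u))) hwt
  simpa [hw_zero] using hw s

/-- The stationary flow into `C`, followed until exit, accumulates the stationary mass of `C`. -/
lemma hasSum_inflow_subMat_pow {q : Matrix S S ℝ} (hq : IsTransition q)
    (hqirr : IsIrreducible q) {μ : S → ℝ} (hμ : IsStationary q μ) {C : Finset S}
    (hC : C ≠ Finset.univ) :
    HasSum (fun n : ℕ => ∑ s ∈ C, (∑ t ∈ Cᶜ, μ t * q t s) * ∑ u ∈ C, (subMat q C ^ n) s u)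
      (∑ s ∈ C, μ s) := by
  set P := subMat q C with hP
  set v : S → ℝ := fun s => if s ∈ C then μ s else 0 with hv
  set ι : S → ℝ := fun s => if s ∈ C then ∑ t ∈ Cᶜ, μ t * q t s else 0 with hι
  have hbal : v = v ᵥ* P + ι := by
    funext s
    by_cases hs : s ∈ C
    · have h := hμ.2.2 s
      rw [← Finset.sum_add_sum_compl C] at h
      simp [hv, hι, hP, vecMul, dotProduct, subMat, hs, ← h, ← ite_and, Finset.sum_ite_mem]
    · simp [hv, hι, hP, vecMul, dotProduct, subMat, hs]
  have hι0 : ∀ s, 0 ≤ ι s := by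
    intro s
    simp only [hι]
    split_ifs
    exacts [Finset.sum_nonneg fun t _ => mul_nonneg (hμ.1 t) (hq.1 t s), le_rfl]
  have hle : ∀ s, (v ᵥ* P) s ≤ v s := fun s => by
    have := congrFun hbal s
    simp only [Pi.add_apply] at this
    linarith [hι0 s]
  have hv0 : ∀ s, 0 ≤ v s := by
    intro s
    simp only [hv]
    split_ifs
    exacts [hμ.1 s, le_rfl]
  have hterm : ∀ n : ℕ, ∑ s ∈ C, (∑ t ∈ Cᶜ, μ t * q t s) * ∑ u ∈ C, (P ^ n) s u =
      ∑ u ∈ C, (ι ᵥ* P ^ n) u := by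
    intro n
    simp only [vecMul, dotProduct, Finset.mul_sum]
    rw [Finset.sum_comm]
    refine Finset.sum_congr rfl fun u _ => ?_
    simp [hι, ite_mul, Finset.sum_ite_mem]
  have hstep : ∀ (n : ℕ) (u : S), (ι ᵥ* P ^ n) u = (v ᵥ* P ^ n) u - (v ᵥ* P ^ (n + 1)) u := by
    intro n u
    have h := congrFun (congrArg (· ᵥ* P ^ n) hbal) u
    simp only [add_vecMul, vecMul_vecMul, ← pow_succ', Pi.add_apply] at h
    linarith
  have hpartial : ∀ N : ℕ, ∑ n ∈ Finset.range N,
      ∑ s ∈ C, (∑ t ∈ Cᶜ, μ t * q t s) * ∑ u ∈ C, (P ^ n) s u =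
        ∑ s ∈ C, μ s - ∑ u ∈ C, (v ᵥ* P ^ N) u := by
    intro N
    simp only [hterm, hstep, Finset.sum_sub_distrib]
    rw [← Finset.sum_sub_distrib, Finset.sum_range_sub' (fun n => ∑ u ∈ C, (v ᵥ* P ^ n) u)]
    simp [hv]
  rw [hasSum_iff_tendsto_nat_of_nonneg]
  · simp only [hpartial]
    have := tendsto_finsetSum C fun u _ => tendsto_vecMul_subMat_pow hq hqirr hC hv0
      (fun s hs => if_neg hs) hle u
    simpa using tendsto_const_nhds.sub this
  · intro n
    exact Finset.sum_nonneg fun s _ => mul_nonneg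
      (Finset.sum_nonneg fun t _ => mul_nonneg (hμ.1 t) (hq.1 t s))
      (Finset.sum_nonneg fun u _ => subMat_pow_nonneg hq C n s u)

/-- Under stationarity the flow into `C` equals the flow out of `C`. -/
lemma inflow_eq_outflow {q : Matrix S S ℝ} (hq : IsTransition q) {μ : S → ℝ}
    (hμ : IsStationary q μ) (C : Finset S) :
    ∑ t ∈ Cᶜ, μ t * ∑ u ∈ C, q t u = ∑ s ∈ C, μ s * ∑ t ∈ Cᶜ, q s t := by
  have hin : ∑ u ∈ C, μ u = ∑ s ∈ C, μ s * ∑ u ∈ C, q s u + ∑ t ∈ Cᶜ, μ t * ∑ u ∈ C, q t u := by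
    rw [Finset.sum_add_sum_compl C fun t => μ t * ∑ u ∈ C, q t u]
    simp only [Finset.mul_sum]
    rw [Finset.sum_comm]
    exact Finset.sum_congr rfl fun u _ => (hμ.2.2 u).symm
  have hout : ∑ s ∈ C, μ s = ∑ s ∈ C, μ s * ∑ u ∈ C, q s u + ∑ s ∈ C, μ s * ∑ t ∈ Cᶜ, q s t := by
    rw [← Finset.sum_add_distrib]
    refine Finset.sum_congr rfl fun s _ => ?_
    rw [← mul_add, Finset.sum_add_sum_compl, hq.2, mul_one]
  linarith

/-- the average length of a visit to `C`, namely
`Σ_{s∈C} ν_C(s)·E_{s,q}[T_{C̄}]` with `ν_C(s) = (Σ_{t∉C} μ_t q(s|t))/(Σ_{t∉C} μ_t q(C|t))`,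
equals `μ_C / Σ_{s∈C} μ_s q(C̄|s)`. -/
theorem average_visit_length_eq
    (hcard : 2 ≤ Fintype.card S)
    (q : Matrix S S ℝ) (hq : IsTransition q) (hqirr : IsIrreducible q)
    (μ : S → ℝ) (hμ : IsStationary q μ)
    (C : Finset S) (hCne : C.Nonempty) (hCproper : C ≠ Finset.univ) :
    ∑ s ∈ C, ENNReal.ofReal
        ((∑ t ∈ Cᶜ, μ t * q t s) / ∑ t ∈ Cᶜ, μ t * ∑ u ∈ C, q t u) * expExit q C s =
      ENNReal.ofReal ((∑ s ∈ C, μ s) / ∑ s ∈ C, μ s * ∑ t ∈ Cᶜ, q s t) := by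
  have hF : 0 ≤ ∑ s ∈ C, μ s * ∑ t ∈ Cᶜ, q s t := Finset.sum_nonneg fun s _ =>
    mul_nonneg (hμ.1 s) (Finset.sum_nonneg fun t _ => hq.1 s t)
  rw [inflow_eq_outflow hq hμ C]
  set F := ∑ s ∈ C, μ s * ∑ t ∈ Cᶜ, q s t
  have hν : ∀ s, 0 ≤ (∑ t ∈ Cᶜ, μ t * q t s) / F := fun s =>
    div_nonneg (Finset.sum_nonneg fun t _ => mul_nonneg (hμ.1 t) (hq.1 t s)) hF
  have hpow : ∀ (n : ℕ) (s : S), 0 ≤ ∑ u ∈ C, (subMat q C ^ n) s u := fun n s =>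
    Finset.sum_nonneg fun u _ => subMat_pow_nonneg hq C n s u
  have hsum : HasSum (fun n : ℕ => ∑ s ∈ C, (∑ t ∈ Cᶜ, μ t * q t s) / F *
      ∑ u ∈ C, (subMat q C ^ n) s u) ((∑ s ∈ C, μ s) / F) := by
    have h := (hasSum_inflow_subMat_pow hq hqirr hμ hCproper).div_const F
    simpa only [Finset.sum_div, mul_div_right_comm] using h
  rw [← hsum.tsum_eq, ENNReal.ofReal_tsum_of_nonneg
    (fun n => Finset.sum_nonneg fun s _ => mul_nonneg (hν s) (hpow n s)) hsum.summable]
  simp only [expExit, ← ENNReal.tsum_mul_left]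
  rw [← Summable.tsum_finsetSum fun _ _ => ENNReal.summable]
  refine tsum_congr fun n => ?_
  rw [ENNReal.ofReal_sum_of_nonneg fun s _ => mul_nonneg (hν s) (hpow n s)]
  exact Finset.sum_congr rfl fun s _ => (ENNReal.ofReal_mul (hν s)).symm

end PerturbedMC
end

section
/- Let a > 0 and let q be an irreducible transition matrix on S satisfying the mixing hypothesis with parameter a on S₁. Then for every y ∈ S₁ there exists an (S₁\{y})-graph ḡ with p(ḡ) ≥ (a/L)^{|S|}·max_{g'∈G(S₁\{y})} p(g') such that every s ∈ S₁\{y} leads to y along ḡ. -/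
open Finset

namespace PerturbedMC

variable {S : Type*} [Fintype S] [DecidableEq S]

/-- Following `g` from `v`, the first state outside `C` exists and belongs to `B`. -/
inductive Reaches {α : Type*} (C : Finset α) (g : α → α) (B : Set α) : α → Prop
  | out {v : α} : v ∉ C → v ∈ B → Reaches C g B v
  | step {v : α} : v ∈ C → Reaches C g B (g v) → Reaches C g B v

section Reaches

variable {α : Type*}

theorem Reaches.of_mem {C : Finset α} {g : α → α} {B : Set α} {v : α}
    (h : Reaches C g B v) (hv : v ∈ C) : Reaches C g B (g v) := by
  cases h with
  | out h1 _ => exact absurd hv h1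
  | step _ h2 => exact h2

theorem Reaches.mem_target {C : Finset α} {g : α → α} {B : Set α} {v : α}
    (h : Reaches C g B v) (hv : v ∉ C) : v ∈ B := by
  cases h with
  | out _ h2 => exact h2
  | step h1 _ => exact absurd h1 hv

theorem Reaches.mono {C : Finset α} {g : α → α} {B B' : Set α} {v : α}
    (h : Reaches C g B v) (hB : B ⊆ B') : Reaches C g B' v := by
  induction h with
  | out h1 h2 => exact .out h1 (hB h2)
  | step h1 _ ih => exact .step h1 ih

theorem Reaches.not_of_disjoint {C : Finset α} {g : α → α} {B B' : Set α} {v : α}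
    (h : Reaches C g B v) (hB : ∀ w ∈ B, w ∉ B') : ¬ Reaches C g B' v := by
  induction h with
  | out h1 h2 => exact fun h' => hB _ h2 (h'.mem_target h1)
  | step h1 _ ih => exact fun h' => ih (h'.of_mem h1)

theorem Reaches.congr {C : Finset α} {g g' : α → α} {B : Set α} {v : α}
    (h : Reaches C g B v) (hg : ∀ w ∈ C, g w = g' w) : Reaches C g' B v := by
  induction h with
  | out h1 h2 => exact .out h1 h2
  | step h1 _ ih => exact .step h1 (hg _ h1 ▸ ih)

theorem Reaches.split {C : Finset α} {g : α → α} {B B₁ B₂ : Set α} {v : α}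
    (h : Reaches C g B v) (hB : ∀ w ∉ C, w ∈ B → w ∈ B₁ ∨ w ∈ B₂) :
    Reaches C g B₁ v ∨ Reaches C g B₂ v := by
  induction h with
  | out h1 h2 => exact (hB _ h1 h2).imp (.out h1) (.out h1)
  | step h1 _ ih => exact ih.imp (.step h1) (.step h1)

theorem leadsTo_of_reaches {C : Finset α} {g : α → α} {v t : α}
    (h : Reaches C g {t} v) : LeadsTo C g v t := by
  induction h with
  | @out v h1 h2 =>
    have : v = t := h2
    subst this
    exact ⟨0, rfl, h1, by simp⟩
  | step h1 _ ih =>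
    obtain ⟨n, hn, ht, hm⟩ := ih
    refine ⟨n + 1, hn, ht, fun m hlt => ?_⟩
    cases m with
    | zero => exact h1
    | succ m => exact hm m (by omega)

theorem isCGraph_iff_reaches [Finite α] {C : Finset α} {g : α → α} :
    IsCGraph C g ↔ ∀ v, Reaches C g Set.univ v := by
  constructor
  · intro hg v
    by_contra hv
    have hn : ∀ n, ¬ Reaches C g Set.univ (g^[n] v) := by
      intro n
      induction n with
      | zero => exact hv
      | succ n ih =>
        intro h
        rw [Function.iterate_succ_apply'] at h
        by_cases hC : g^[n] v ∈ C
        · exact ih (.step hC h)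
        · exact ih (.out hC trivial)
    have hC : ∀ n, g^[n] v ∈ C := fun n => by
      by_contra h
      exact hn n (.out h trivial)
    obtain ⟨i, j, hij, he⟩ := Finite.exists_ne_map_eq_of_infinite (fun n : ℕ => g^[n] v)
    wlog hlt : i < j generalizing i j
    · exact this j i hij.symm he.symm (by omega)
    refine hg ⟨j - i, fun m => g^[i + m] v, by omega, ?_, fun m _ => hC _, fun m _ => ?_⟩
    · simpa [Nat.add_sub_cancel' hlt.le] using he.symm
    · simp only [← add_assoc]
      exact (Function.iterate_succ_apply' g (i + m) v).symm
  · rintro hg ⟨k, f, hk, hfk, hC, hf⟩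
    have key : ∀ v, Reaches C g Set.univ v → ∀ i < k, f i ≠ v := by
      intro v h
      induction h with
      | out h1 _ => exact fun i hi he => h1 (he ▸ hC i hi)
      | step _ _ ih =>
        intro i hi he
        have h2 := hf i hi
        rw [he] at h2
        rcases Nat.lt_or_ge (i + 1) k with h3 | h3
        · exact ih _ h3 h2.symm
        · have : i + 1 = k := by omega
          rw [this, hfk] at h2
          exact ih 0 hk h2.symm
    exact key _ (hg (f 0)) 0 hk rfl

theorem IsCGraph.subset {C D : Finset α} {g : α → α} (hg : IsCGraph C g) (hD : D ⊆ C) :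
    IsCGraph D g := fun ⟨k, f, hk, hfk, hC, hf⟩ => hg ⟨k, f, hk, hfk, fun i hi => hD (hC i hi), hf⟩

theorem IsCGraph.congr {C : Finset α} {g g' : α → α} (hg : IsCGraph C g)
    (h : ∀ v ∈ C, g v = g' v) : IsCGraph C g' := fun ⟨k, f, hk, hfk, hC, hf⟩ =>
  hg ⟨k, f, hk, hfk, hC, fun i hi => (h _ (hC i hi)).trans (hf i hi)⟩

theorem IsCGraph.apply_ne {C : Finset α} {g : α → α} (hg : IsCGraph C g) {v : α} (hv : v ∈ C) :
    g v ≠ v := fun h => hg ⟨1, fun _ => v, one_pos, rfl, fun _ _ => hv, fun _ _ => h⟩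

theorem Reaches.of_erase [DecidableEq α] {C : Finset α} {s : α} {g : α → α} {B : Set α} {v : α}
    (h : Reaches (C.erase s) g B v) (hB : s ∉ B) : Reaches C g B v := by
  induction h with
  | @out v h1 h2 =>
    have : v ≠ s := by rintro rfl; exact hB h2
    exact .out (fun h => h1 (mem_erase.2 ⟨this, h⟩)) h2
  | step h1 _ ih => exact .step (mem_of_mem_erase h1) ih

theorem Reaches.erase [DecidableEq α] {C : Finset α} {s : α} {g : α → α} {B : Set α} {v : α}
    (h : Reaches C g B v) :
    Reaches (C.erase s) g B v ∨ Reaches (C.erase s) g {s} v := by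
  induction h with
  | out h1 h2 => exact .inl (.out (fun h => h1 (mem_of_mem_erase h)) h2)
  | @step v h1 _ ih =>
    by_cases hv : v = s
    · exact .inr (.out (by simp [hv]) hv)
    · exact ih.imp (.step (mem_erase.2 ⟨hv, h1⟩)) (.step (mem_erase.2 ⟨hv, h1⟩))

theorem Reaches.trans_erase [DecidableEq α] {C : Finset α} {s : α} {g : α → α} {B : Set α} {v : α}
    (h : Reaches (C.erase s) g {s} v) (hs : Reaches C g B s) : Reaches C g B v := by
  induction h with
  | @out v _ h2 =>
    have : v = s := h2
    exact this ▸ hs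
  | step h1 _ ih => exact .step (mem_of_mem_erase h1) ih

theorem isCGraph_erase_iff [Finite α] [DecidableEq α] {C : Finset α} {s : α} {g : α → α} (hs : s ∈ C) :
    IsCGraph C g ↔ IsCGraph (C.erase s) g ∧ ¬ Reaches (C.erase s) g {s} (g s) := by
  constructor
  · intro hg
    refine ⟨hg.subset (erase_subset _ _), fun hr => ?_⟩
    have key : ∀ v, Reaches C g Set.univ v → ¬ Reaches (C.erase s) g {s} v := by
      intro v h
      induction h with
      | @out v h1 _ =>
        intro h
        have : v = s := h.mem_target fun h => h1 (mem_of_mem_erase h)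
        exact h1 (this ▸ hs)
      | @step v h1 _ ih =>
        intro h
        by_cases hv : v = s
        · exact ih (hv ▸ hr)
        · exact ih (h.of_mem (mem_erase.2 ⟨hv, h1⟩))
    exact key _ (isCGraph_iff_reaches.1 hg _) hr
  · rintro ⟨hg, hr⟩
    rw [isCGraph_iff_reaches] at hg ⊢
    have hsr : Reaches C g Set.univ s := by
      rcases (hg (g s)).split (B₁ := {s}) (B₂ := {s}ᶜ)
        (fun w _ _ => Classical.em (w = s)) with h | h
      · exact absurd h hr
      · exact .step hs ((h.of_erase (by simp)).mono (Set.subset_univ _))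
    intro v
    rcases (hg v).split (B₁ := {s}) (B₂ := {s}ᶜ) (fun w _ _ => Classical.em (w = s)) with h | h
    · exact h.trans_erase hsr
    · exact (h.of_erase (by simp)).mono (Set.subset_univ _)

theorem IsCGraph.reaches_iff_erase [Finite α] [DecidableEq α] {C : Finset α} {s : α} {g : α → α} {B : Set α}
    {v : α} (hg : IsCGraph C g) (hs : s ∈ C) (hB : s ∉ B) :
    Reaches C g B v ↔ Reaches (C.erase s) g B v ∨
      (Reaches (C.erase s) g {s} v ∧ Reaches (C.erase s) g B (g s)) := by
  have hr := ((isCGraph_erase_iff hs).1 hg).2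
  constructor
  · intro h
    refine h.erase.imp_right fun h1 => ⟨h1, ?_⟩
    have h2 : Reaches C g B s := by
      rcases (isCGraph_iff_reaches.1 hg s).split (B₁ := B) (B₂ := Bᶜ)
        (fun w _ _ => Classical.em (w ∈ B)) with h2 | h2
      · exact h2
      · exact absurd (h1.trans_erase h2) (h.not_of_disjoint fun w hw hw' => hw' hw)
    exact (h2.of_mem hs).erase.resolve_right hr
  · rintro (h | ⟨h1, h2⟩)
    · exact h.of_erase hB
    · exact h1.trans_erase (.step hs (h2.of_erase hB))

theorem wt_nonneg {q : Matrix α α ℝ} (hq : ∀ s t, 0 ≤ q s t) (C : Finset α) (g : α → α) :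
    0 ≤ wt q C g := prod_nonneg fun _ _ => hq _ _

theorem wt_congr {q : Matrix α α ℝ} {C : Finset α} {g g' : α → α} (h : ∀ v ∈ C, g v = g' v) :
    wt q C g = wt q C g' := prod_congr rfl fun v hv => by rw [h v hv]

/-- The swap underlying the Markov chain tree formula: exchange an extra edge `s → u` with the
edge `s → g s`. -/
theorem mul_wt_update [DecidableEq α] (q : Matrix α α ℝ) {C : Finset α} {s : α} (hs : s ∈ C) (u : α)
    (g : α → α) :
    q s (g s) * wt q C (Function.update g s u) = q s u * wt q C g := by
  have h1 : wt q (C.erase s) (Function.update g s u) = wt q (C.erase s) g :=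
    wt_congr fun v hv => Function.update_of_ne (ne_of_mem_erase hv) _ _
  have h2 : ∀ g, wt q C g = q s (g s) * wt q (C.erase s) g := fun g =>
    (mul_prod_erase C (fun v => q v (g v)) hs).symm
  rw [h2, h2 g, h1, Function.update_self]
  ring

theorem reaches_erase_update [DecidableEq α] {C : Finset α} {s u v : α} {g : α → α} {B : Set α} :
    Reaches (C.erase s) (Function.update g s u) B v ↔ Reaches (C.erase s) g B v :=
  ⟨fun h => h.congr fun _ hw => Function.update_of_ne (ne_of_mem_erase hw) _ _,
    fun h => h.congr fun _ hw => (Function.update_of_ne (ne_of_mem_erase hw) _ _).symm⟩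

end Reaches

theorem mem_Gset {C : Finset S} {g : S → S} :
    g ∈ Gset C ↔ IsCGraph C g ∧ ∀ s ∉ C, g s = s := by
  simp [Gset]

open Classical in
/-- The total weight of the `C`-graphs along which `v` leads into `B`. -/
noncomputable def leadWeight (q : Matrix S S ℝ) (C : Finset S) (B : Set S) (v : S) : ℝ :=
  ∑ g ∈ Gset C with Reaches C g B v, wt q C g

theorem update_mem_Gset {C : Finset S} {s u : S} {g : S → S} (hg : g ∈ Gset C) (hs : s ∈ C)
    (hu : ¬ Reaches (C.erase s) g {s} u) : Function.update g s u ∈ Gset C := by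
  rw [mem_Gset] at hg ⊢
  refine ⟨(isCGraph_erase_iff hs).2 ⟨?_, ?_⟩, fun v hv => ?_⟩
  · exact (hg.1.subset (erase_subset s C)).congr fun v hv =>
      (Function.update_of_ne (ne_of_mem_erase hv) _ _).symm
  · rwa [reaches_erase_update, Function.update_self]
  · rw [Function.update_of_ne (by rintro rfl; exact hv hs), hg.2 v hv]

open Classical in
/-- The total weight of graphs leading from a state into `B` is harmonic on `C`. -/
theorem leadWeight_harmonic {q : Matrix S S ℝ} (hq : IsTransition q) {C : Finset S} {B : Set S}
    {s : S} (hs : s ∈ C) (hB : s ∉ B) :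
    ∑ u, q s u * leadWeight q C B u = leadWeight q C B s := by
  have hR : leadWeight q C B s = ∑ u, q s u * leadWeight q C B s := by
    rw [← sum_mul, hq.2, one_mul]
  rw [hR]
  simp only [leadWeight, mul_sum, sum_filter, ← sum_product', mul_ite, mul_zero]
  rw [← sum_filter, ← sum_filter]
  have hsr : ∀ g ∈ Gset C, (Reaches C g B s ↔ Reaches (C.erase s) g B (g s)) := by
    intro g hg
    rw [(mem_Gset.1 hg).1.reaches_iff_erase hs hB]
    have h1 : ¬ Reaches (C.erase s) g B s := fun h => hB (h.mem_target (by simp))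
    have h2 : Reaches (C.erase s) g {s} s := .out (by simp) rfl
    tauto
  set e := C.erase s
  set B' : Set S := {v | v ∉ B ∧ v ≠ s} with hB'
  have hBs : ∀ g v, Reaches e g B v → ¬ Reaches e g {s} v := fun g v h =>
    h.not_of_disjoint fun w hw hw' => hB ((show w = s from hw') ▸ hw)
  have hB's : ∀ g v, Reaches e g B' v → ¬ Reaches e g {s} v := fun g v h =>
    h.not_of_disjoint fun w hw hw' => hw.2 hw'
  have hBB' : ∀ g v, Reaches e g B v → ¬ Reaches e g B' v := fun g v h =>
    h.not_of_disjoint fun w hw hw' => hw'.1 hw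
  have htri : ∀ g ∈ Gset C, ∀ v,
      Reaches e g B v ∨ Reaches e g B' v ∨ Reaches e g {s} v := by
    intro g hg v
    have h := isCGraph_iff_reaches.1 ((isCGraph_erase_iff hs).1 (mem_Gset.1 hg).1).1 v
    rcases h.split (B₁ := B) (B₂ := Bᶜ) (fun w _ _ => Classical.em (w ∈ B)) with h | h
    · exact .inl h
    · refine .inr (h.split fun w _ hw => ?_)
      by_cases hws : w = s
      · exact .inr hws
      · exact .inl ⟨hw, hws⟩
  have hup : ∀ u g v, Reaches e (Function.update g s u) B' v ↔ Reaches e g B' v :=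
    fun _ _ _ => reaches_erase_update
  refine sum_bij'
    (fun p _ => if Reaches e p.2 B' (p.2 s) then (p.2 s, Function.update p.2 s p.1) else p)
    (fun p _ => if Reaches e p.2 B' p.1 then (p.2 s, Function.update p.2 s p.1) else p)
    ?_ ?_ ?_ ?_ ?_
  · rintro ⟨u, g⟩ hp
    simp only [mem_filter, mem_product, mem_univ, true_and] at hp ⊢
    obtain ⟨hg, hr⟩ := hp
    rw [(mem_Gset.1 hg).1.reaches_iff_erase hs hB] at hr
    split_ifs with h
    · have h1 : Reaches e g B u := hr.resolve_right fun h' => hBB' _ _ h'.2 h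
      have hmem := update_mem_Gset hg hs (hBs _ _ h1)
      refine ⟨hmem, ?_⟩
      rw [hsr _ hmem, reaches_erase_update, Function.update_self]
      exact h1
    · refine ⟨hg, (hsr g hg).2 ?_⟩
      exact ((htri g hg (g s)).resolve_right fun h' =>
        h'.elim h ((isCGraph_erase_iff hs).1 (mem_Gset.1 hg).1).2)
  · rintro ⟨u, g⟩ hp
    simp only [mem_filter, mem_product, mem_univ, true_and] at hp ⊢
    obtain ⟨hg, hr⟩ := hp
    rw [hsr g hg] at hr
    split_ifs with h
    · have hmem := update_mem_Gset hg hs (hB's _ _ h)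
      refine ⟨hmem, ?_⟩
      rw [(mem_Gset.1 hmem).1.reaches_iff_erase hs hB]
      exact .inl (reaches_erase_update.2 hr)
    · refine ⟨hg, ?_⟩
      rw [(mem_Gset.1 hg).1.reaches_iff_erase hs hB]
      rcases htri g hg u with h1 | h1 | h1
      · exact .inl h1
      · exact absurd h1 h
      · exact .inr ⟨h1, hr⟩
  · rintro ⟨u, g⟩ hp
    simp only [mem_filter, mem_product, mem_univ, true_and] at hp
    obtain ⟨hg, hr⟩ := hp
    rw [(mem_Gset.1 hg).1.reaches_iff_erase hs hB] at hr
    by_cases h : Reaches e g B' (g s)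
    · simp [h, hup]
    · have h1 : ¬ Reaches e g B' u := by
        intro h1
        rcases hr with h2 | h2
        · exact hBB' _ _ h2 h1
        · exact hB's _ _ h1 h2.1
      simp [h, h1]
  · rintro ⟨u, g⟩ hp
    simp only [mem_filter, mem_product, mem_univ, true_and] at hp
    obtain ⟨hg, hr⟩ := hp
    rw [hsr g hg] at hr
    by_cases h : Reaches e g B' u
    · simp [h, hup]
    · simp [h, hBB' _ _ hr]
  · rintro ⟨u, g⟩ _
    dsimp only
    split_ifs
    · exact (mul_wt_update q hs u g).symm
    · rfl

theorem leadWeight_nonneg {q : Matrix S S ℝ} (hq : ∀ s t, 0 ≤ q s t) (C : Finset S) (B : Set S)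
    (v : S) : 0 ≤ leadWeight q C B v := sum_nonneg fun _ _ => wt_nonneg hq _ _

open Classical in
theorem leadWeight_le {q : Matrix S S ℝ} (hq : ∀ s t, 0 ≤ q s t) (C : Finset S) (B : Set S)
    (v : S) : leadWeight q C B v ≤ ∑ g ∈ Gset C, wt q C g :=
  sum_le_sum_of_subset_of_nonneg (filter_subset _ _) fun _ _ _ => wt_nonneg hq _ _

open Classical in
theorem leadWeight_of_mem_target (q : Matrix S S ℝ) {C : Finset S} {B : Set S} {v : S}
    (hC : v ∉ C) (hB : v ∈ B) : leadWeight q C B v = ∑ g ∈ Gset C, wt q C g := by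
  rw [leadWeight, filter_true_of_mem fun _ _ => Reaches.out hC hB]

/-- A function superharmonic on `C` with value `1` at `y` dominates the probability of
exiting `C` at `y`. -/
theorem exitProb_le_of_superharmonic {q : Matrix S S ℝ} (hq : ∀ s t, 0 ≤ q s t) {C : Finset S}
    {y : S} (hy : y ∉ C) {H : S → ℝ} (hH : ∀ v, 0 ≤ H v) (hHy : H y = 1)
    (hsup : ∀ u ∈ C, ∑ v, q u v * H v ≤ H u) {u : S} (hu : u ∈ C) :
    exitProb q C u y ≤ H u := by
  have hM : ∀ u v, 0 ≤ subMat q C u v := fun u v => by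
    unfold subMat
    split_ifs
    exacts [hq _ _, le_rfl]
  have hMn : ∀ n u v, 0 ≤ (subMat q C ^ n) u v := by
    intro n
    induction n with
    | zero => intro u v; rw [pow_zero, Matrix.one_apply]; split_ifs <;> norm_num
    | succ n ih =>
      intro u v
      rw [pow_succ, Matrix.mul_apply]
      exact sum_nonneg fun w _ => mul_nonneg (ih _ _) (hM _ _)
  refine Real.tsum_le_of_sum_range_le
    (fun n => sum_nonneg fun w _ => mul_nonneg (hMn n u w) (hq _ _)) fun N => ?_
  induction N generalizing u with
  | zero => simpa using hH u
  | succ N ih =>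
    rw [sum_range_succ']
    have h0 : ∑ w ∈ C, (subMat q C ^ 0) u w * q w y = q u y := by
      simp [Matrix.one_apply, hu]
    have hS : ∑ n ∈ range N, ∑ w ∈ C, (subMat q C ^ (n + 1)) u w * q w y =
        ∑ v ∈ C, q u v * ∑ n ∈ range N, ∑ w ∈ C, (subMat q C ^ n) v w * q w y := by
      simp only [mul_sum]
      rw [sum_comm (s := C)]
      refine sum_congr rfl fun n _ => ?_
      rw [sum_comm (s := C)]
      refine sum_congr rfl fun w _ => ?_
      rw [pow_succ', Matrix.mul_apply, sum_mul]
      rw [← sum_subset (subset_univ C)]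
      · refine sum_congr rfl fun v hv => ?_
        simp [subMat, hu, hv, mul_assoc]
      · intro v _ hv
        simp [subMat, hv]
    rw [h0, hS]
    calc _ ≤ ∑ v ∈ C, q u v * H v + q u y * H y := by
            rw [hHy, mul_one]
            gcongr with v hv
            · exact hq _ _
            · exact ih hv
      _ = ∑ v ∈ insert y C, q u v * H v := by rw [sum_insert hy, add_comm]
      _ ≤ ∑ v, q u v * H v := sum_le_sum_of_subset_of_nonneg (subset_univ _)
            fun v _ _ => mul_nonneg (hq _ _) (hH _)
      _ ≤ H u := hsup u hu

theorem Mixing.le_of_superharmonic {q : Matrix S S ℝ} (hq : ∀ s t, 0 ≤ q s t) {S1 : Finset S}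
    {a : ℝ} (hmix : Mixing q S1 a) {s y : S} (hs : s ∈ S1) (hy : y ∈ S1)
    {H : S → ℝ} (hH : ∀ v, 0 ≤ H v) (hHy : H y = 1)
    (hsup : ∀ u ∈ S1.erase y, ∑ v, q u v * H v ≤ H u) :
    a ≤ ∑ v, q s v * H v := by
  have hyC : y ∉ S1.erase y := notMem_erase y S1
  calc a ≤ _ := hmix s hs y hy
    _ ≤ q s y * H y + ∑ v ∈ S1.erase y, q s v * H v := by
        rw [hHy, mul_one]
        gcongr with v hv
        · exact hq _ _
        · exact exitProb_le_of_superharmonic hq hyC hH hHy hsup hv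
    _ = ∑ v ∈ insert y (S1.erase y), q s v * H v := by rw [sum_insert hyC]
    _ ≤ ∑ v, q s v * H v := sum_le_sum_of_subset_of_nonneg (subset_univ _)
          fun v _ _ => mul_nonneg (hq _ _) (hH _)

theorem Mixing.le_one {q : Matrix S S ℝ} (hq : IsTransition q) {S1 : Finset S}
    {a : ℝ} (hmix : Mixing q S1 a) {y : S} (hy : y ∈ S1) : a ≤ 1 := by
  have := hmix.le_of_superharmonic hq.1 hy hy (H := fun _ => 1) (fun _ => zero_le_one) rfl
    (fun u _ => by simp [hq.2])
  simpa [hq.2] using this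

theorem card_Gset_le (hcard : 2 ≤ Fintype.card S) (C : Finset S) :
    (Gset C).card ≤ Lconst S := by
  have h1 : Gset C ⊆ Fintype.piFinset fun v => if v ∈ C then univ.erase v else {v} := by
    intro g hg
    rw [mem_Gset] at hg
    rw [Fintype.mem_piFinset]
    intro v
    split_ifs with hv
    · exact mem_erase.2 ⟨hg.1.apply_ne hv, mem_univ _⟩
    · exact mem_singleton.2 (hg.2 v hv)
  calc (Gset C).card ≤ _ := card_le_card h1
    _ = ∏ v : S, (if v ∈ C then univ.erase v else {v} : Finset S).card :=
        Fintype.card_piFinset _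
    _ ≤ ∏ _v : S, (Fintype.card S - 1) := by
        refine prod_le_prod' fun v _ => ?_
        split_ifs
        · rw [card_erase_of_mem (mem_univ _), card_univ]
        · rw [card_singleton]; omega
    _ = (Fintype.card S - 1) ^ Fintype.card S := by simp
    _ ≤ (Fintype.card S).choose (Fintype.card S - 1) *
          (Fintype.card S - 1) ^ Fintype.card S :=
        Nat.le_mul_of_pos_left _ (Nat.choose_pos (by omega))
    _ ≤ Lconst S := single_le_sum
        (f := fun n => (Fintype.card S).choose n * n ^ Fintype.card S)
        (fun _ _ => Nat.zero_le _) (mem_Ico.2 ⟨by omega, by omega⟩)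

theorem Lconst_pos (hcard : 2 ≤ Fintype.card S) : 0 < Lconst S := by
  refine lt_of_lt_of_le (card_pos.2 ⟨id, ?_⟩) (card_Gset_le hcard (∅ : Finset S))
  rw [mem_Gset]
  exact ⟨fun ⟨k, f, hk, _, hC, _⟩ => by simpa using hC 0 hk, fun _ _ => rfl⟩

theorem wt_le_sum_Gset {q : Matrix S S ℝ} (hq : ∀ s t, 0 ≤ q s t) {C : Finset S} {g : S → S}
    (hg : IsCGraph C g) : wt q C g ≤ ∑ g ∈ Gset C, wt q C g := by
  have he : ∀ v ∈ C, g v = if v ∈ C then g v else v := fun v hv => by simp [hv]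
  rw [wt_congr he]
  refine single_le_sum (f := wt q C) (fun _ _ => wt_nonneg hq _ _) (mem_Gset.2 ⟨hg.congr he, ?_⟩)
  intro v hv
  simp [hv]

/-- Under mixing, any `s ∈ D` leads into `S₁ \ D` along some `a/L`-maximal `D`-graph. -/
theorem Mixing.exists_isMaximal_reaches (hcard : 2 ≤ Fintype.card S)
    {q : Matrix S S ℝ} (hq : IsTransition q) {S1 : Finset S} {a : ℝ} (ha : 0 < a)
    (hmix : Mixing q S1 a) {y : S} (hy : y ∈ S1) {D : Finset S} (hD : D ⊆ S1.erase y)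
    {s : S} (hs : s ∈ D) :
    ∃ h, IsMaximal q D (a / (Lconst S : ℝ)) h ∧ Reaches D h {v | v ∈ S1 ∧ v ∉ D} s := by
  classical
  set B : Set S := {v | v ∈ S1 ∧ v ∉ D} with hB
  set Z := ∑ g ∈ Gset D, wt q D g with hZ
  have hyD : y ∉ D := fun h => notMem_erase y S1 (hD h)
  have hL : (0 : ℝ) < Lconst S := by exact_mod_cast Lconst_pos hcard
  have hZ0 : 0 ≤ Z := sum_nonneg fun _ _ => wt_nonneg hq.1 _ _
  rcases hZ0.eq_or_lt with hZ0 | hZ0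
  · have hr : ∀ v (T : Set S), y ∈ T → v ∈ D → Reaches D (fun _ => y) T v :=
      fun v T hT hv => .step hv (.out hyD hT)
    refine ⟨fun _ => y, ⟨isCGraph_iff_reaches.2 fun v => ?_, fun g' hg' => ?_⟩,
      hr s B ⟨hy, hyD⟩ hs⟩
    · by_cases hv : v ∈ D
      · exact hr v _ trivial hv
      · exact .out hv trivial
    · have h0 : wt q D g' = 0 :=
        le_antisymm (hZ0 ▸ wt_le_sum_Gset hq.1 hg') (wt_nonneg hq.1 _ _)
      rw [h0, mul_zero]
      exact wt_nonneg hq.1 _ _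
  · have hH0 : ∀ v, 0 ≤ leadWeight q D B v / Z := fun v =>
      div_nonneg (leadWeight_nonneg hq.1 _ _ _) hZ0.le
    have hH1 : ∀ v, leadWeight q D B v / Z ≤ 1 := fun v =>
      (div_le_one hZ0).2 (leadWeight_le hq.1 _ _ _)
    have hHB : ∀ v ∈ B, leadWeight q D B v / Z = 1 := fun v hv => by
      rw [leadWeight_of_mem_target q hv.2 hv, div_self hZ0.ne']
    have hharm : ∀ u ∈ D, ∑ v, q u v * (leadWeight q D B v / Z) = leadWeight q D B u / Z := by
      intro u hu
      rw [← leadWeight_harmonic hq hu (fun h : u ∈ B => h.2 hu), sum_div]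
      exact sum_congr rfl fun v _ => (mul_div_assoc _ _ _).symm
    have key := hmix.le_of_superharmonic hq.1 (mem_of_mem_erase (hD hs)) hy
      (H := fun v => leadWeight q D B v / Z) hH0 (hHB y ⟨hy, hyD⟩) (by
        intro u hu
        by_cases huD : u ∈ D
        · exact (hharm u huD).le
        · rw [hHB u ⟨mem_of_mem_erase hu, huD⟩, ← hq.2 u]
          exact sum_le_sum fun v _ => mul_le_of_le_one_right (hq.1 _ _) (hH1 v))
    rw [hharm s hs, le_div_iff₀ hZ0] at key
    have hne : ((Gset D).filter fun g => Reaches D g B s).Nonempty := by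
      by_contra hne
      rw [leadWeight, not_nonempty_iff_eq_empty.1 hne, sum_empty] at key
      exact absurd key (not_le.2 (mul_pos ha hZ0))
    obtain ⟨h, hmem, hmax⟩ := exists_max_image _ (wt q D) hne
    have hmem' := mem_filter.1 hmem
    refine ⟨h, ⟨(mem_Gset.1 hmem'.1).1, fun g' hg' => ?_⟩, hmem'.2⟩
    have h1 : leadWeight q D B s ≤ Lconst S * wt q D h := by
      refine (sum_le_card_nsmul _ _ _ hmax).trans ?_
      rw [nsmul_eq_mul]
      refine mul_le_mul_of_nonneg_right ?_ (wt_nonneg hq.1 _ _)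
      exact_mod_cast (card_le_card (filter_subset _ _)).trans (card_Gset_le hcard D)
    rw [div_mul_eq_mul_div, div_le_iff₀ hL, mul_comm (wt q D h)]
    exact ((mul_le_mul_of_nonneg_left (wt_le_sum_Gset hq.1 hg') ha.le).trans key).trans h1

open Classical in
/-- Regrafting the states of `C` that do not lead to `y`, so that `s` does. -/
theorem exists_improvement {q : Matrix S S ℝ} (hq : ∀ s t, 0 ≤ q s t) {C : Finset S} {y : S}
    {g h : S → S} {η : ℝ} (hy : y ∉ C) (hg : IsCGraph C g) {D : Finset S}
    (hD : D = C.filter fun v => ¬ Reaches C g {y} v) (hh : IsMaximal q D η h)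
    {s : S} (hsh : Reaches D h {v | v ∈ insert y C ∧ v ∉ D} s) :
    ∃ g', IsCGraph C g' ∧ η * wt q C g ≤ wt q C g' ∧
      (∀ v, Reaches C g {y} v → Reaches C g' {y} v) ∧ Reaches C g' {y} s := by
  have hDC : D ⊆ C := hD ▸ filter_subset _ _
  have hCD : ∀ v ∈ C, v ∉ D → Reaches C g {y} v := by
    intro v hv hvD
    by_contra hr
    exact hvD (hD ▸ mem_filter.2 ⟨hv, hr⟩)
  set g' : S → S := fun v => if v ∈ D then h v else g v with hg'
  have hpres : ∀ v, Reaches C g {y} v → Reaches C g' {y} v := by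
    intro v hv
    induction hv with
    | out h1 h2 => exact .out h1 h2
    | @step v h1 h2 ih =>
      have hvD : v ∉ D := fun hvD => by
        rw [hD] at hvD
        exact (mem_filter.1 hvD).2 (.step h1 h2)
      refine .step h1 ?_
      simpa [hg', hvD] using ih
  have hstep : ∀ v ∈ D, ∀ T, Reaches C g' T (h v) → Reaches C g' T v := by
    intro v hv T hr
    refine .step (hDC hv) ?_
    simpa [hg', hv] using hr
  refine ⟨g', isCGraph_iff_reaches.2 fun v => ?_, ?_, hpres, ?_⟩
  · have hv := isCGraph_iff_reaches.1 hh.1 v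
    induction hv with
    | @out v h1 _ =>
      by_cases hv : v ∈ C
      · exact (hpres v (hCD v hv h1)).mono (Set.subset_univ _)
      · exact .out hv trivial
    | step h1 _ ih => exact hstep _ h1 _ ih
  · have hw : ∀ f, wt q C f = wt q (C \ D) f * wt q D f := fun f =>
      (prod_sdiff hDC).symm
    have h1 : wt q (C \ D) g' = wt q (C \ D) g :=
      wt_congr fun v hv => by simp [hg', (mem_sdiff.1 hv).2]
    have h2 : wt q D g' = wt q D h := wt_congr fun v hv => by simp [hg', hv]
    rw [hw, hw g', h1, h2, mul_left_comm]
    exact mul_le_mul_of_nonneg_left (hh.2 g (hg.subset hDC)) (wt_nonneg hq _ _)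
  · induction hsh with
    | @out v h1 h2 =>
      rcases mem_insert.1 h2.1 with rfl | hv
      · exact .out hy rfl
      · exact hpres v (hCD v hv h1)
    | step h1 _ ih => exact hstep _ h1 _ ih

/-- Lemma `a`: under the mixing hypothesis with parameter `a` on `S₁`, for
every `y ∈ S₁` there is an `(a/L)^{|S|}`-maximal `(S₁∖{y})`-graph all of whose paths lead
to `y`. -/
theorem exists_maximal_graph_leading_to
    (hcard : 2 ≤ Fintype.card S)
    (q : Matrix S S ℝ) (hq : IsTransition q) (hqirr : IsIrreducible q)
    (S1 : Finset S) (hS1 : 1 < S1.card)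
    (a : ℝ) (ha : 0 < a) (hmix : Mixing q S1 a) :
    ∀ y ∈ S1, ∃ g : S → S,
      IsMaximal q (S1.erase y) ((a / (Lconst S : ℝ)) ^ Fintype.card S) g ∧
        ∀ s ∈ S1.erase y, LeadsTo (S1.erase y) g s y := by
  classical
  intro y hy
  set C := S1.erase y with hC
  set η : ℝ := a / (Lconst S : ℝ) with hη
  have hyC : y ∉ C := notMem_erase y S1
  have hL : (1 : ℝ) ≤ Lconst S := by exact_mod_cast Lconst_pos hcard
  have hη0 : 0 ≤ η := by positivity
  have hη1 : η ≤ 1 := div_le_one_of_le₀ ((hmix.le_one hq hy).trans hL) (by positivity)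
  have key : ∀ n : ℕ, ∃ g, IsMaximal q C (η ^ n) g ∧
      ((∀ s ∈ C, Reaches C g {y} s) ∨ n ≤ (C.filter fun s => Reaches C g {y} s).card) := by
    intro n
    induction n with
    | zero =>
      have hne : (univ.filter fun g : S → S => IsCGraph C g).Nonempty := by
        refine ⟨fun _ => y, mem_filter.2 ⟨mem_univ _, isCGraph_iff_reaches.2 fun v => ?_⟩⟩
        by_cases hv : v ∈ C
        · exact .step hv (.out hyC trivial)
        · exact .out hv trivial
      obtain ⟨g, hg, hmax⟩ := exists_max_image _ (wt q C) hne
      refine ⟨g, ⟨(mem_filter.1 hg).2, fun g' hg' => ?_⟩, .inr (Nat.zero_le _)⟩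
      rw [pow_zero, one_mul]
      exact hmax g' (mem_filter.2 ⟨mem_univ _, hg'⟩)
    | succ n ih =>
      obtain ⟨g, hg, hlead⟩ := ih
      by_cases hall : ∀ s ∈ C, Reaches C g {y} s
      · refine ⟨g, ⟨hg.1, fun g' hg' => le_trans ?_ (hg.2 g' hg')⟩, .inl hall⟩
        exact mul_le_mul_of_nonneg_right (pow_le_pow_of_le_one hη0 hη1 n.le_succ)
          (wt_nonneg hq.1 _ _)
      · push Not at hall
        obtain ⟨s, hsC, hs⟩ := hall
        have hn := hlead.resolve_left fun h => hs (h s hsC)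
        obtain ⟨h, hh, hsh⟩ := hmix.exists_isMaximal_reaches hcard hq ha hy
          (D := C.filter fun v => ¬ Reaches C g {y} v) (filter_subset _ _)
          (mem_filter.2 ⟨hsC, hs⟩)
        rw [← insert_erase hy] at hsh
        obtain ⟨g', hg', hw, hpres, hsg'⟩ := exists_improvement hq.1 hyC hg.1 rfl hh hsh
        refine ⟨g', ⟨hg', fun f hf => ?_⟩, .inr ?_⟩
        · rw [pow_succ', mul_assoc]
          exact (mul_le_mul_of_nonneg_left (hg.2 f hf) hη0).trans hw
        · refine hn.trans_lt (card_lt_card ?_)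
          rw [ssubset_iff_of_subset (monotone_filter_right _ fun v _ => hpres v)]
          exact ⟨s, mem_filter.2 ⟨hsC, hsg'⟩, fun h => hs (mem_filter.1 h).2⟩
  obtain ⟨g, hg, hlead⟩ := key (Fintype.card S)
  refine ⟨g, hg, fun s hs => leadsTo_of_reaches (hlead.resolve_right (fun h => ?_) s hs)⟩
  have hlt : C.card < Fintype.card S :=
    card_lt_univ_of_notMem hyC
  exact absurd (h.trans (card_filter_le _ _)) (not_le.2 hlt)

end PerturbedMC
end
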